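/- Let T > 0 and 1 < p < ∞. The infimum of I_p(v) = (∫₀ᵀ v'²)/(∫₀ᵀ |v|^{2p/(p-1)})^{(p-1)/p} over nonzero v ∈ X_p^per = { v ∈ H^1(0,T) : v(0)=v(T), ∫₀ᵀ |v|^{2/(p-1)} v = 0 } is attained: there exists u₀ ∈ X_p^per \ {0} with I_p(u₀) = inf I_p. -/

import Mathlib

open Set Filter Topology MeasureTheory

def Adm (T q : ℝ) (v v' : ℝ → ℝ) : Prop :=
  (∀ t ∈ Set.Icc (0:ℝ) T, HasDerivWithinAt v (v' t) (Set.Icc 0 T) t) ∧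
  ContinuousOn v' (Set.Icc 0 T) ∧ v 0 = v T ∧
  (∫ t in (0:ℝ)..T, |v t| ^ q * v t) = 0

lemma cont_g {q : ℝ} (hq : 0 < q) : Continuous fun x : ℝ => |x| ^ q * x :=
  (continuous_abs.rpow_const (fun _ => Or.inr hq.le)).mul continuous_id

lemma cont_s {q : ℝ} (hq : 0 < q) : Continuous fun x : ℝ => |x| ^ (q + 2) :=
  (continuous_abs.rpow_const (fun _ => Or.inr (by linarith)))

lemma tangent {q : ℝ} (hq : 0 < q) (a b : ℝ) :
    |b| ^ (q + 2) + (q + 2) * (|b| ^ q * b * (a - b)) ≤ |a| ^ (q + 2) := by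
  have hs : (q + 2).HolderConjugate ((q + 2) / (q + 1)) := by
    rw [Real.holderConjugate_iff]
    refine ⟨by linarith, ?_⟩
    field_simp; ring
  have hy := Real.young_inequality_of_nonneg (abs_nonneg a)
    (Real.rpow_nonneg (abs_nonneg b) (q + 1)) hs
  rw [← Real.rpow_mul (abs_nonneg b)] at hy
  have e1 : (q + 1) * ((q + 2) / (q + 1)) = q + 2 := by field_simp
  rw [e1] at hy
  have e2 : |b| ^ (q + 1) = |b| ^ q * |b| := by
    rw [Real.rpow_add_of_nonneg (abs_nonneg b) hq.le (by norm_num), Real.rpow_one]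
  have e3 : |b| ^ (q + 2) = |b| ^ q * b ^ 2 := by
    rw [Real.rpow_add_of_nonneg (abs_nonneg b) hq.le (by norm_num)]
    norm_num
  have hB : 0 ≤ |b| ^ q := Real.rpow_nonneg (abs_nonneg b) q
  have hab : |b| ^ q * (a * b) ≤ |b| ^ q * (|a| * |b|) :=
    mul_le_mul_of_nonneg_left (by rw [← abs_mul]; exact le_abs_self _) hB
  rw [e2] at hy
  have hy2 : (q + 2) * (|a| * (|b| ^ q * |b|)) ≤ |a| ^ (q + 2) + (q + 1) * |b| ^ (q + 2) := by
    have := mul_le_mul_of_nonneg_left hy (by linarith : 0 ≤ q + 2)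
    refine this.trans (le_of_eq ?_)
    field_simp
  have h3 := mul_le_mul_of_nonneg_left hab (by linarith : 0 ≤ q + 2)
  rw [e3] at hy2 ⊢
  nlinarith

lemma cs {a b : ℝ} (hab : a ≤ b) {f g : ℝ → ℝ} (hf : ContinuousOn f (Icc a b))
    (hg : ContinuousOn g (Icc a b)) :
    (∫ t in a..b, f t * g t) ^ 2 ≤ (∫ t in a..b, f t ^ 2) * (∫ t in a..b, g t ^ 2) := by
  have i1 : IntervalIntegrable (fun t => f t ^ 2) volume a b := (hf.pow 2).intervalIntegrable_of_Icc (μ := volume) hab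
  have i2 : IntervalIntegrable (fun t => g t ^ 2) volume a b := (hg.pow 2).intervalIntegrable_of_Icc (μ := volume) hab
  have i3 : IntervalIntegrable (fun t => f t * g t) volume a b := (hf.mul hg).intervalIntegrable_of_Icc (μ := volume) hab
  have := discrim_le_zero (a := ∫ t in a..b, g t ^ 2) (b := 2 * ∫ t in a..b, f t * g t)
    (c := ∫ t in a..b, f t ^ 2) (by
      intro x
      have h0 : 0 ≤ ∫ t in a..b, (f t + x * g t) ^ 2 :=
        intervalIntegral.integral_nonneg hab (fun _ _ => sq_nonneg _)
      have : (∫ t in a..b, (f t + x * g t) ^ 2) = ∫ t in a..b,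
          ((x * x) * g t ^ 2 + (2 * x) * (f t * g t) + f t ^ 2) := by
        congr 1; ext t; ring
      rw [this, intervalIntegral.integral_add ((i2.const_mul _).add (i3.const_mul _)) i1,
        intervalIntegral.integral_add (i2.const_mul _) (i3.const_mul _),
        intervalIntegral.integral_const_mul, intervalIntegral.integral_const_mul] at h0
      linarith)
  rw [discrim] at this
  nlinarith

lemma ftc {T : ℝ} {v v' : ℝ → ℝ}
    (h : ∀ t ∈ Set.Icc (0:ℝ) T, HasDerivWithinAt v (v' t) (Set.Icc 0 T) t)
    (hc : ContinuousOn v' (Icc 0 T)) {a b : ℝ} (ha : 0 ≤ a) (hab : a ≤ b) (hb : b ≤ T) :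
    ∫ t in a..b, v' t = v b - v a := by
  have hsub : Icc a b ⊆ Icc 0 T := Icc_subset_Icc ha hb
  refine intervalIntegral.integral_eq_sub_of_hasDerivAt_of_le hab ?_ ?_ ?_
  · exact fun t ht => ((h t (hsub ht)).continuousWithinAt).mono hsub
  · intro x hx
    exact (h x (hsub (Ioo_subset_Icc_self hx))).hasDerivAt
      (Icc_mem_nhds (by linarith [hx.1]) (by linarith [hx.2]))
  · exact (hc.mono hsub).intervalIntegrable_of_Icc hab

lemma holder_aux {T : ℝ} {v v' : ℝ → ℝ}
    (h : ∀ t ∈ Set.Icc (0:ℝ) T, HasDerivWithinAt v (v' t) (Set.Icc 0 T) t)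
    (hc : ContinuousOn v' (Icc 0 T)) {a b : ℝ} (ha : 0 ≤ a) (hab : a ≤ b) (hb : b ≤ T) :
    (v b - v a) ^ 2 ≤ (b - a) * ∫ t in (0:ℝ)..T, v' t ^ 2 := by
  have hsub : Icc a b ⊆ Icc 0 T := Icc_subset_Icc ha hb
  have := cs hab (f := fun _ => 1) (g := v') continuousOn_const (hc.mono hsub)
  simp only [one_mul, one_pow, intervalIntegral.integral_const, smul_eq_mul, mul_one] at this
  rw [ftc h hc ha hab hb] at this
  refine this.trans (mul_le_mul_of_nonneg_left ?_ (by linarith))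
  refine intervalIntegral.integral_mono_interval ha hab hb ?_ ?_
  · exact Eventually.of_forall (fun x => sq_nonneg _)
  · exact (hc.pow 2).intervalIntegrable_of_Icc (by linarith)

lemma holder {T : ℝ} {v v' : ℝ → ℝ}
    (h : ∀ t ∈ Set.Icc (0:ℝ) T, HasDerivWithinAt v (v' t) (Set.Icc 0 T) t)
    (hc : ContinuousOn v' (Icc 0 T)) {a b : ℝ} (ha : a ∈ Icc 0 T) (hb : b ∈ Icc 0 T) :
    (v a - v b) ^ 2 ≤ |a - b| * ∫ t in (0:ℝ)..T, v' t ^ 2 := by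
  rcases le_total a b with hab | hab
  · have := holder_aux h hc ha.1 hab hb.2
    rw [abs_sub_comm, abs_of_nonneg (by linarith)]
    nlinarith
  · have := holder_aux h hc hb.1 hab ha.2
    rw [abs_of_nonneg (by linarith)]
    nlinarith

lemma Adm.cont {T q : ℝ} {v v' : ℝ → ℝ} (h : Adm T q v v') : ContinuousOn v (Icc 0 T) :=
  fun t ht => (h.1 t ht).continuousWithinAt

lemma Adm.zero {T q : ℝ} (hT : 0 < T) (hq : 0 < q) {v v' : ℝ → ℝ} (h : Adm T q v v') :
    ∃ t ∈ Icc (0:ℝ) T, v t = 0 := by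
  obtain ⟨c, hc, h2⟩ := exists_eq_interval_average hT.ne (f := fun t => |v t| ^ q * v t) (by
    rw [uIcc_of_le hT.le]; exact (cont_g hq).comp_continuousOn h.cont)
  rw [interval_average_eq, h.2.2.2, smul_zero] at h2
  rw [uIoo_of_le hT.le] at hc
  refine ⟨c, Ioo_subset_Icc_self hc, ?_⟩
  rcases mul_eq_zero.1 h2 with h3 | h3
  · have := (Real.rpow_eq_zero (abs_nonneg _) hq.ne').1 h3
    simpa using this
  · exact h3

lemma Adm.bound {T q : ℝ} (hT : 0 < T) (hq : 0 < q) {v v' : ℝ → ℝ} (h : Adm T q v v')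
    {t : ℝ} (ht : t ∈ Icc (0:ℝ) T) : v t ^ 2 ≤ T * ∫ t in (0:ℝ)..T, v' t ^ 2 := by
  obtain ⟨c, hc, h2⟩ := h.zero hT hq
  have := holder h.1 h.2.1 ht hc
  rw [h2, sub_zero] at this
  refine this.trans (mul_le_mul_of_nonneg_right ?_ ?_)
  · rw [abs_le]; constructor <;> linarith [ht.1, ht.2, hc.1, hc.2]
  · exact intervalIntegral.integral_nonneg hT.le (fun _ _ => sq_nonneg _)

lemma exists_shift {T q : ℝ} (hT : 0 < T) (hq : 0 < q) {z : ℝ → ℝ} (hz : Continuous z) :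
    ∃ c, (∫ t in (0:ℝ)..T, |z t - c| ^ q * (z t - c)) = 0 := by
  have hcont : Continuous fun c : ℝ => ∫ t in (0:ℝ)..T, |z t - c| ^ q * (z t - c) := by
    apply intervalIntegral.continuous_parametric_intervalIntegral_of_continuous'
    exact (cont_g hq).comp (by fun_prop : Continuous fun p : ℝ × ℝ => z p.2 - p.1)
  obtain ⟨B, hB⟩ := (isCompact_Icc (a := (0:ℝ)) (b := T)).exists_bound_of_continuousOn hz.continuousOn
  have := mem_range_of_exists_le_of_exists_ge (c := 0) hcont ⟨B, ?_⟩ ⟨-B, ?_⟩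
  · exact this
  · have : 0 ≤ ∫ t in (0:ℝ)..T, -(|z t - B| ^ q * (z t - B)) := by
      apply intervalIntegral.integral_nonneg hT.le
      intro t ht
      have := (abs_le.1 (hB t ht)).2
      have h2 := mul_nonneg (Real.rpow_nonneg (abs_nonneg (z t - B)) q) (by linarith : 0 ≤ B - z t)
      linarith
    rw [intervalIntegral.integral_neg] at this
    linarith
  · apply intervalIntegral.integral_nonneg hT.le
    intro t ht
    have := (abs_le.1 (hB t ht)).1
    exact mul_nonneg (Real.rpow_nonneg (abs_nonneg _) q) (by linarith)

lemma mkAdm {T q : ℝ} (hT : 0 < T) (hq : 0 < q) {k : ℝ → ℝ} (hk : Continuous k)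
    (h0 : ∫ t in (0:ℝ)..T, k t = 0) : ∃ v, Continuous v ∧ Adm T q v k := by
  have hd : ∀ t, HasDerivAt (fun u => ∫ x in (0:ℝ)..u, k x) (k t) t :=
    fun t => (hk.integral_hasStrictDerivAt 0 t).hasDerivAt
  have hz : Continuous (fun u => ∫ x in (0:ℝ)..u, k x) :=
    continuous_iff_continuousAt.2 fun t => (hd t).continuousAt
  obtain ⟨c, hc⟩ := exists_shift hT hq hz
  refine ⟨fun u => (∫ x in (0:ℝ)..u, k x) - c, by fun_prop, ?_, hk.continuousOn, ?_, hc⟩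
  · intro t _
    exact ((hd t).sub_const c).hasDerivWithinAt
  · simp [h0]

lemma exists_nonzero {T q : ℝ} (hT : 0 < T) (hq : 0 < q) :
    ∃ v v', Adm T q v v' ∧ (∫ t in (0:ℝ)..T, v' t ^ 2) ≤ 1 ∧ ∃ t ∈ Icc (0:ℝ) T, v t ≠ 0 := by
  set A : ℝ := ∫ t in (0:ℝ)..T, (T - 2 * t) ^ 2 with hA
  have hA0 : 0 ≤ A := intervalIntegral.integral_nonneg hT.le (fun _ _ => sq_nonneg _)
  obtain ⟨v, -, hv⟩ := mkAdm hT hq (k := fun t => (1 + A)⁻¹ * (T - 2 * t)) (by fun_prop) (by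
    rw [intervalIntegral.integral_const_mul, intervalIntegral.integral_sub (by simp)
      (Continuous.intervalIntegrable (by fun_prop) _ _)]
    rw [intervalIntegral.integral_const_mul, integral_id, intervalIntegral.integral_const]
    simp only [smul_eq_mul]
    ring)
  refine ⟨v, _, hv, ?_, ?_⟩
  · simp only [mul_pow]
    rw [intervalIntegral.integral_const_mul, ← hA, inv_pow, inv_mul_le_iff₀ (by positivity)]
    nlinarith
  · by_contra! hcon
    have h0 : (0:ℝ) ∈ Icc 0 T := ⟨le_rfl, hT.le⟩
    have h1 : HasDerivWithinAt v 0 (Icc 0 T) 0 :=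
      (hasDerivWithinAt_const 0 (Icc 0 T) (0:ℝ)).congr (fun x hx => hcon x hx) (hcon 0 h0)
    have h2 := (uniqueDiffOn_Icc hT 0 h0).eq_deriv _ (hv.1 0 h0) h1
    have : 0 < (1 + A)⁻¹ * (T - 2 * 0) := by simp; positivity
    linarith

lemma ibp {T q : ℝ} (hT : 0 < T) {v v' K h : ℝ → ℝ} (hv : Adm T q v v')
    (hK : ∀ t, HasDerivAt K (h t) t) (hh : Continuous h) (hKT : K T = K 0) :
    ∫ t in (0:ℝ)..T, h t * v t = - ∫ t in (0:ℝ)..T, K t * v' t := by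
  have hKc : Continuous K := continuous_iff_continuousAt.2 fun t => (hK t).continuousAt
  have c1 : ContinuousOn (fun t => h t * v t) (Icc 0 T) := hh.continuousOn.mul hv.cont
  have c2 : ContinuousOn (fun t => K t * v' t) (Icc 0 T) := hKc.continuousOn.mul hv.2.1
  have := ftc (T := T) (v := fun t => K t * v t) (v' := fun t => h t * v t + K t * v' t)
    (fun t ht => (hK t).hasDerivWithinAt.mul (hv.1 t ht)) (c1.add c2) le_rfl hT.le le_rfl
  rw [intervalIntegral.integral_add (c1.intervalIntegrable_of_Icc hT.le)
    (c2.intervalIntegrable_of_Icc hT.le), hKT, hv.2.2.1] at this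
  linarith

lemma core {T q : ℝ} (hT : 0 < T) (hq : 0 < q) :
    ∃ u u', Adm T q u u' ∧ (∫ t in (0:ℝ)..T, u' t ^ 2) = 1 ∧
      (0 < ∫ t in (0:ℝ)..T, |u t| ^ (q + 2)) ∧
      ∀ v v', Adm T q v v' → (∫ t in (0:ℝ)..T, v' t ^ 2) ≤ 1 →
        (∫ t in (0:ℝ)..T, |v t| ^ (q + 2)) ≤ ∫ t in (0:ℝ)..T, |u t| ^ (q + 2) := by
  let P : ℝ → Icc (0:ℝ) T := projIcc 0 T hT.le
  have hP : Continuous P := continuous_projIcc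
  have hPt : ∀ t ∈ Icc (0:ℝ) T, (P t : ℝ) = t := fun t ht => by
    simp only [P]; rw [projIcc_of_mem hT.le ht]
  let S : Set (BoundedContinuousFunction (Icc (0:ℝ) T) ℝ) :=
    {u | ∃ v v', Adm T q v v' ∧ (∫ t in (0:ℝ)..T, v' t ^ 2) ≤ 1 ∧ ∀ x : Icc (0:ℝ) T, u x = v x}
  have hmem : ∀ v v', Adm T q v v' → (∫ t in (0:ℝ)..T, v' t ^ 2) ≤ 1 →
      ∃ u ∈ S, ∀ t ∈ Icc (0:ℝ) T, u (P t) = v t := by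
    intro v v' hv he
    refine ⟨BoundedContinuousFunction.mkOfCompact
      ⟨fun x => v x, continuousOn_iff_continuous_domRestrict.1 hv.cont⟩, ⟨v, v', hv, he, ?_⟩, ?_⟩
    · intro x; rfl
    · intro t ht
      change v (P t) = v t
      rw [hPt t ht]
  have hScomp : IsCompact (closure S) := by
    refine BoundedContinuousFunction.arzela_ascoli (Icc (-√T) (√T)) isCompact_Icc S ?_ ?_
    · rintro u x ⟨v, v', hv, he, hu⟩
      rw [hu x, mem_Icc, ← abs_le]
      apply Real.abs_le_sqrt
      have := hv.bound hT hq x.2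
      nlinarith
    · refine Metric.equicontinuous_of_continuity_modulus (fun d => √d) ?_ _ ?_
      · have := Real.continuous_sqrt.tendsto 0
        simpa using this
      · rintro x y ⟨u, v, v', hv, he, hu⟩
        change dist (u x) (u y) ≤ _
        rw [hu x, hu y, Real.dist_eq]
        apply Real.abs_le_sqrt
        have := holder hv.1 hv.2.1 x.2 y.2
        rw [Subtype.dist_eq, Real.dist_eq]
        have h2 := abs_nonneg ((x:ℝ) - y)
        nlinarith
  have hev : Continuous fun p : (BoundedContinuousFunction (Icc (0:ℝ) T) ℝ) × ℝ => p.1 (P p.2) := by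
    fun_prop
  have hcs : Continuous fun u : BoundedContinuousFunction (Icc (0:ℝ) T) ℝ =>
      ∫ t in (0:ℝ)..T, |u (P t)| ^ (q + 2) := by
    apply intervalIntegral.continuous_parametric_intervalIntegral_of_continuous'
    exact (cont_s hq).comp hev
  have hcg : Continuous fun u : BoundedContinuousFunction (Icc (0:ℝ) T) ℝ =>
      ∫ t in (0:ℝ)..T, |u (P t)| ^ q * u (P t) := by
    apply intervalIntegral.continuous_parametric_intervalIntegral_of_continuous'
    exact (cont_g hq).comp hev
  have hSnon : (closure S).Nonempty := by
    obtain ⟨v, v', hv, he, -⟩ := exists_nonzero hT hq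
    obtain ⟨u, hu, -⟩ := hmem v v' hv he
    exact ⟨u, subset_closure hu⟩
  have hcongr : ∀ (F : ℝ → ℝ) (G : ℝ → ℝ), (∀ t ∈ Icc (0:ℝ) T, F t = G t) →
      ∫ t in (0:ℝ)..T, F t = ∫ t in (0:ℝ)..T, G t := by
    intro F G h
    apply intervalIntegral.integral_congr
    rw [uIcc_of_le hT.le]
    exact h
  obtain ⟨u, huS, hmax⟩ := hScomp.exists_isMaxOn hSnon hcs.continuousOn
  set M := ∫ t in (0:ℝ)..T, |u (P t)| ^ (q + 2) with hM
  have hmaxv : ∀ v v', Adm T q v v' → (∫ t in (0:ℝ)..T, v' t ^ 2) ≤ 1 →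
        (∫ t in (0:ℝ)..T, |v t| ^ (q + 2)) ≤ M := by
    intro v v' hv he
    obtain ⟨w, hw, hwv⟩ := hmem v v' hv he
    have := hmax (subset_closure hw)
    refine le_trans (le_of_eq ?_) this
    exact hcongr _ _ fun t ht => by rw [hwv t ht]
  have hMpos : 0 < M := by
    obtain ⟨v, v', hv, he, t, ht, hvt⟩ := exists_nonzero hT hq
    refine lt_of_lt_of_le ?_ (hmaxv v v' hv he)
    refine intervalIntegral.integral_pos hT ((cont_s hq).comp_continuousOn hv.cont)
      (fun x _ => Real.rpow_nonneg (abs_nonneg _) _) ⟨t, ht, Real.rpow_pos_of_pos (abs_pos.2 hvt) _⟩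
  have hug : ∫ t in (0:ℝ)..T, |u (P t)| ^ q * u (P t) = 0 := by
    have : closure S ⊆ {u | ∫ t in (0:ℝ)..T, |u (P t)| ^ q * u (P t) = 0} := by
      refine closure_minimal ?_ (isClosed_eq hcg continuous_const)
      rintro w ⟨v, v', hv, he, hw⟩
      rw [mem_ofPred_eq]
      refine Eq.trans ?_ hv.2.2.2
      exact hcongr _ _ fun t ht => by rw [hw, hPt t ht]
    exact this huS
  -- the dual function
  let h : ℝ → ℝ := fun t => |u (P t)| ^ q * u (P t)
  have huc : Continuous fun t => u (P t) := by fun_prop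
  have hh : Continuous h := (cont_g hq).comp huc
  let H : ℝ → ℝ := fun t => ∫ x in (0:ℝ)..t, h x
  have hHd : ∀ t, HasDerivAt H (h t) t := fun t => (hh.integral_hasStrictDerivAt 0 t).hasDerivAt
  have hHc : Continuous H := continuous_iff_continuousAt.2 fun t => (hHd t).continuousAt
  let m : ℝ := (∫ t in (0:ℝ)..T, H t) / T
  let K : ℝ → ℝ := fun t => H t - m
  have hKd : ∀ t, HasDerivAt K (h t) t := fun t => (hHd t).sub_const m
  have hKc : Continuous K := hHc.sub continuous_const
  have hKT : K T = K 0 := by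
    have : H T = 0 := hug
    have h0 : H 0 = 0 := by simp [H]
    simp only [K, this, h0]
  have hK0 : ∫ t in (0:ℝ)..T, K t = 0 := by
    simp only [K]
    rw [intervalIntegral.integral_sub (hHc.intervalIntegrable _ _) (by simp),
      intervalIntegral.integral_const]
    simp only [m, smul_eq_mul]
    field_simp
    ring
  set Q := ∫ t in (0:ℝ)..T, K t ^ 2 with hQ
  have hQ0 : 0 ≤ Q := intervalIntegral.integral_nonneg hT.le (fun _ _ => sq_nonneg _)
  have hhu : ∫ t in (0:ℝ)..T, h t * u (P t) = M := by
    refine hcongr _ _ fun t _ => ?_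
    simp only [h]
    rw [Real.rpow_add_of_nonneg (abs_nonneg _) hq.le (by norm_num)]
    norm_num
    ring
  have hMQ : M ≤ √Q := by
    have hcl : Continuous fun w : BoundedContinuousFunction (Icc (0:ℝ) T) ℝ =>
        ∫ t in (0:ℝ)..T, h t * w (P t) := by
      apply intervalIntegral.continuous_parametric_intervalIntegral_of_continuous'
      exact (hh.comp continuous_snd).mul hev
    have : closure S ⊆ {w | ∫ t in (0:ℝ)..T, h t * w (P t) ≤ √Q} := by
      refine closure_minimal ?_ (isClosed_le hcl continuous_const)
      rintro w ⟨v, v', hv, he, hw⟩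
      have e1 : ∫ t in (0:ℝ)..T, h t * w (P t) = ∫ t in (0:ℝ)..T, h t * v t :=
        hcongr _ _ fun t ht => by rw [hw, hPt t ht]
      rw [mem_ofPred_eq, e1, ibp hT hv hKd hh hKT]
      have := cs hT.le hKc.continuousOn hv.2.1
      refine (neg_le_abs _).trans (Real.abs_le_sqrt (this.trans ?_))
      rw [← hQ]
      nlinarith
    have := this huS
    rw [mem_ofPred_eq, hhu] at this
    exact this
  have hN : 0 < √Q := lt_of_lt_of_le hMpos hMQ
  have hNsq : √Q * √Q = Q := Real.mul_self_sqrt hQ0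
  obtain ⟨z, hzc, hz⟩ := mkAdm hT hq (k := fun t => -(√Q)⁻¹ * K t) (by fun_prop) (by
    rw [intervalIntegral.integral_const_mul, hK0, mul_zero])
  have hzM : M ≤ ∫ t in (0:ℝ)..T, |z t| ^ (q + 2) := by
    have e := ibp hT hz hKd hh hKT
    have e2 : ∫ t in (0:ℝ)..T, K t * (-(√Q)⁻¹ * K t) = -√Q := by
      have : ∀ t, K t * (-(√Q)⁻¹ * K t) = -(√Q)⁻¹ * K t ^ 2 := fun t => by ring
      simp only [this]
      rw [intervalIntegral.integral_const_mul, ← hQ]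
      field_simp
      linarith
    rw [e2, neg_neg] at e
    have i1 : IntervalIntegrable (fun t => |u (P t)| ^ (q + 2)) volume 0 T :=
      ((cont_s hq).comp huc).intervalIntegrable _ _
    have i2 : IntervalIntegrable (fun t => h t * z t) volume 0 T :=
      (hh.mul hzc).intervalIntegrable _ _
    have i3 : IntervalIntegrable (fun t => h t * u (P t)) volume 0 T :=
      (hh.mul huc).intervalIntegrable _ _
    have i4 : IntervalIntegrable (fun t => |z t| ^ (q + 2)) volume 0 T :=
      ((cont_s hq).comp hzc).intervalIntegrable _ _
    have := intervalIntegral.integral_mono_on hT.le (i1.add ((i2.sub i3).const_mul (q + 2))) i4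
      (fun t _ => by
        have := tangent hq (z t) (u (P t))
        simp only [h]
        rw [← mul_sub]
        exact this)
    rw [intervalIntegral.integral_add i1 ((i2.sub i3).const_mul (q + 2)),
      intervalIntegral.integral_const_mul, intervalIntegral.integral_sub i2 i3, e, hhu, ← hM] at this
    have h5 : 0 ≤ (q + 2) * (√Q - M) := mul_nonneg (by linarith) (by linarith)
    linarith
  refine ⟨z, _, hz, ?_, lt_of_lt_of_le hMpos hzM, fun v v' hv he => (hmaxv v v' hv he).trans hzM⟩
  simp only [mul_pow]
  rw [intervalIntegral.integral_const_mul, ← hQ, neg_sq, inv_pow, Real.sq_sqrt hQ0]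
  have : 0 < Q := Real.sqrt_pos.1 hN
  field_simp

theorem stmt14 (T p : ℝ) (hT : 0 < T) (hp : 1 < p) :
    ∃ u₀ u₀' : ℝ → ℝ,
      (∀ t ∈ Set.Icc (0:ℝ) T, HasDerivWithinAt u₀ (u₀' t) (Set.Icc 0 T) t) ∧
      ContinuousOn u₀' (Set.Icc 0 T) ∧
      u₀ 0 = u₀ T ∧
      (∫ t in (0:ℝ)..T, |u₀ t| ^ (2 / (p - 1)) * u₀ t) = 0 ∧
      (∃ t ∈ Set.Icc (0:ℝ) T, u₀ t ≠ 0) ∧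
      ∀ v v' : ℝ → ℝ,
        (∀ t ∈ Set.Icc (0:ℝ) T, HasDerivWithinAt v (v' t) (Set.Icc 0 T) t) →
        ContinuousOn v' (Set.Icc 0 T) → v 0 = v T →
        (∫ t in (0:ℝ)..T, |v t| ^ (2 / (p - 1)) * v t) = 0 →
        (∃ t ∈ Set.Icc (0:ℝ) T, v t ≠ 0) →
        (∫ t in (0:ℝ)..T, (u₀' t) ^ 2) /
            (∫ t in (0:ℝ)..T, |u₀ t| ^ (2 * p / (p - 1))) ^ ((p - 1) / p) ≤
          (∫ t in (0:ℝ)..T, (v' t) ^ 2) /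
            (∫ t in (0:ℝ)..T, |v t| ^ (2 * p / (p - 1))) ^ ((p - 1) / p) := by
  have hp1 : 0 < p - 1 := by linarith
  have hq : 0 < 2 / (p - 1) := by positivity
  have es : 2 * p / (p - 1) = 2 / (p - 1) + 2 := by field_simp; ring
  have er : (p - 1) / p = 2 / (2 / (p - 1) + 2) := by
    rw [← es]; field_simp
  rw [er]
  simp only [es]
  generalize 2 / (p - 1) = q at hq
  obtain ⟨u, u', hu, he, hpos, hmax⟩ := core hT hq
  refine ⟨u, u', hu.1, hu.2.1, hu.2.2.1, hu.2.2.2, ?_, ?_⟩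
  · by_contra! hcon
    have : ∫ t in (0:ℝ)..T, |u t| ^ (q + 2) = ∫ t in (0:ℝ)..T, (0:ℝ) := by
      apply intervalIntegral.integral_congr
      rw [uIcc_of_le hT.le]
      intro t ht
      simp only [hcon t ht, abs_zero]
      exact Real.zero_rpow (by linarith)
    rw [this] at hpos
    simp at hpos
  · rintro v v' h1 h2 h3 h4 ⟨t, ht, hvt⟩
    have hv : Adm T q v v' := ⟨h1, h2, h3, h4⟩
    set E := ∫ t in (0:ℝ)..T, v' t ^ 2 with hE
    set U := ∫ t in (0:ℝ)..T, |u t| ^ (q + 2) with hU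
    have hEpos : 0 < E := by
      have := hv.bound hT hq ht
      have h5 : 0 < v t ^ 2 := by positivity
      by_contra hcon
      nlinarith
    have hvpos : 0 < ∫ t in (0:ℝ)..T, |v t| ^ (q + 2) :=
      intervalIntegral.integral_pos hT ((cont_s hq).comp_continuousOn hv.cont)
        (fun x _ => Real.rpow_nonneg (abs_nonneg _) _)
        ⟨t, ht, Real.rpow_pos_of_pos (abs_pos.2 hvt) _⟩
    set c := (√E)⁻¹ with hc
    have hcpos : 0 < c := by positivity
    have hc2 : c ^ 2 * E = 1 := by
      rw [hc, inv_pow, Real.sq_sqrt hEpos.le]; field_simp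
    have hw : Adm T q (fun t => c * v t) (fun t => c * v' t) := by
      refine ⟨fun t ht => (h1 t ht).const_mul c, continuousOn_const.mul h2, by simp only [h3], ?_⟩
      have : ∀ t, |c * v t| ^ q * (c * v t) = (|c| ^ q * c) * (|v t| ^ q * v t) := fun t => by
        rw [abs_mul, Real.mul_rpow (abs_nonneg _) (abs_nonneg _)]; ring
      simp only [this]
      rw [intervalIntegral.integral_const_mul, h4, mul_zero]
    have h6 := hmax _ _ hw (by
      simp only [mul_pow]
      rw [intervalIntegral.integral_const_mul, ← hE, hc2])
    simp only [abs_mul, Real.mul_rpow (abs_nonneg _) (abs_nonneg _)] at h6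
    rw [intervalIntegral.integral_const_mul, abs_of_pos hcpos] at h6
    set V := ∫ t in (0:ℝ)..T, |v t| ^ (q + 2) with hV
    have h7 := Real.rpow_le_rpow (by positivity) h6 (by positivity : 0 ≤ 2 / (q + 2))
    rw [Real.mul_rpow (by positivity) hvpos.le, ← Real.rpow_mul hcpos.le,
      mul_div_cancel₀ _ (by linarith : q + 2 ≠ 0), Real.rpow_two] at h7
    have hV2 : 0 < V ^ (2 / (q + 2)) := Real.rpow_pos_of_pos hvpos _
    have hU2 : 0 < U ^ (2 / (q + 2)) := Real.rpow_pos_of_pos hpos _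
    rw [he, div_le_div_iff₀ hU2 hV2, one_mul]
    calc V ^ (2 / (q + 2)) = E * (c ^ 2 * V ^ (2 / (q + 2))) := by
          rw [← mul_assoc, mul_comm E, hc2, one_mul]
      _ ≤ _ := mul_le_mul_of_nonneg_left h7 hEpos.le
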